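/- Let Φ(x) = 2(1 − 1/x)^{x−1} Γ(1/2 + x/2) Γ(x) / (Γ(1 + x/2) Γ(−1/2 + x)) for real x > 1. For every real s > −1, the logarithmic derivative of s ↦ Φ(s + 2) satisfies F(s) := Φ′(s + 2)/Φ(s + 2) = log((1 + s)/(1 + s/2)) − Σ_{n=0}^{∞} [ 1/(n + 3/2 + s/2) − 1/(n + 3/2 + s) ]. -/

import Mathlib

noncomputable def Phi (x : ℝ) : ℝ :=
  2 * (1 - 1 / x) ^ (x - 1) * (Real.Gamma (1/2 + x/2) * Real.Gamma x) /
    (Real.Gamma (1 + x/2) * Real.Gamma (-1/2 + x))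

theorem Real.hasDerivAt_log_Gamma {x : ℝ} (hx : 0 < x) :
    HasDerivAt (fun y => Real.log (Real.Gamma y)) (deriv (fun y => Real.log (Real.Gamma y)) x) x := by
  have h : DifferentiableAt ℝ Real.Gamma x :=
    Real.differentiableAt_Gamma fun m => by
      have : (0 : ℝ) ≤ m := m.cast_nonneg
      linarith
  exact (h.log (Real.Gamma_pos_of_pos hx).ne').hasDerivAt

theorem Real.log_Gamma_add_one {x : ℝ} (hx : 0 < x) :
    Real.log (Real.Gamma (x + 1)) = Real.log (Real.Gamma x) + Real.log x := by
  rw [Real.Gamma_add_one hx.ne', Real.log_mul hx.ne' (Real.Gamma_pos_of_pos hx).ne', add_comm]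

theorem Real.deriv_log_Gamma_add_one {x : ℝ} (hx : 0 < x) :
    deriv (fun y => Real.log (Real.Gamma y)) (x + 1) =
      deriv (fun y => Real.log (Real.Gamma y)) x + 1 / x := by
  have h1 : HasDerivAt (fun y => Real.log (Real.Gamma (y + 1)))
      (deriv (fun y => Real.log (Real.Gamma y)) (x + 1)) x :=
    (Real.hasDerivAt_log_Gamma (by linarith : 0 < x + 1)).comp_add_const x 1
  have h2 := (Real.hasDerivAt_log_Gamma hx).add (Real.hasDerivAt_log hx.ne')
  rw [one_div]
  refine h1.unique (h2.congr_of_eventuallyEq ?_)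
  filter_upwards [eventually_gt_nhds hx] with y hy
  exact Real.log_Gamma_add_one hy

theorem Real.deriv_log_Gamma_le_log {x : ℝ} (hx : 0 < x) :
    deriv (fun y => Real.log (Real.Gamma y)) x ≤ Real.log x := by
  have h := Real.convexOn_log_Gamma.le_slope_of_hasDerivAt (x := x) (y := x + 1)
    hx (by simp; linarith) (by linarith) (Real.hasDerivAt_log_Gamma hx)
  rw [slope_def_field] at h
  simpa [Real.log_Gamma_add_one hx] using h

theorem Real.log_le_deriv_log_Gamma_add_one {x : ℝ} (hx : 0 < x) :
    Real.log x ≤ deriv (fun y => Real.log (Real.Gamma y)) (x + 1) := by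
  have h := Real.convexOn_log_Gamma.slope_le_of_hasDerivAt (x := x) (y := x + 1)
    hx (by simp; linarith) (by linarith) (Real.hasDerivAt_log_Gamma (by linarith))
  rw [slope_def_field] at h
  simpa [Real.log_Gamma_add_one hx] using h

open Filter Topology in
theorem Real.tendsto_deriv_log_Gamma_sub_log :
    Tendsto (fun x => deriv (fun y => Real.log (Real.Gamma y)) x - Real.log x) atTop (𝓝 0) := by
  have h : Tendsto (fun x : ℝ => -(1 / x)) atTop (𝓝 0) := by
    simpa using (tendsto_inv_atTop_zero (𝕜 := ℝ)).neg
  refine tendsto_of_tendsto_of_tendsto_of_le_of_le' h tendsto_const_nhds ?_ ?_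
  · filter_upwards [eventually_gt_atTop 0] with x hx
    have := Real.log_le_deriv_log_Gamma_add_one hx
    rw [Real.deriv_log_Gamma_add_one hx] at this
    linarith
  · filter_upwards [eventually_gt_atTop 0] with x hx
    linarith [Real.deriv_log_Gamma_le_log hx]

open Filter Topology in
theorem Real.tendsto_deriv_log_Gamma_add_sub_log (a : ℝ) :
    Tendsto (fun n : ℕ => deriv (fun y => Real.log (Real.Gamma y)) (n + a) - Real.log n)
      atTop (𝓝 0) := by
  have h1 := Real.tendsto_deriv_log_Gamma_sub_log.comp
    (tendsto_atTop_add_const_right atTop a (tendsto_natCast_atTop_atTop (R := ℝ)))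
  have h2 := (Real.tendsto_log_comp_add_sub_log a).comp (tendsto_natCast_atTop_atTop (R := ℝ))
  simpa [Function.comp_def] using h1.add h2

theorem Real.deriv_log_Gamma_nat_add {a : ℝ} (ha : 0 < a) (n : ℕ) :
    deriv (fun y => Real.log (Real.Gamma y)) (n + a) =
      deriv (fun y => Real.log (Real.Gamma y)) a + ∑ i ∈ Finset.range n, 1 / ((i : ℝ) + a) := by
  induction n with
  | zero => simp
  | succ n ih =>
    rw [Finset.sum_range_succ, ← add_assoc, ← ih, ← Real.deriv_log_Gamma_add_one (by positivity)]
    congr 1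
    push_cast
    ring

theorem Real.hasSum_deriv_log_Gamma_sub_of_le {a b : ℝ} (ha : 0 < a) (hab : a ≤ b) :
    HasSum (fun n : ℕ => 1 / ((n : ℝ) + a) - 1 / ((n : ℝ) + b))
      (deriv (fun y => Real.log (Real.Gamma y)) b -
        deriv (fun y => Real.log (Real.Gamma y)) a) := by
  rw [hasSum_iff_tendsto_nat_of_nonneg]
  · have h := ((Real.tendsto_deriv_log_Gamma_add_sub_log a).sub
      (Real.tendsto_deriv_log_Gamma_add_sub_log b)).add_const
      (deriv (fun y => Real.log (Real.Gamma y)) b - deriv (fun y => Real.log (Real.Gamma y)) a)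
    rw [sub_zero, zero_add] at h
    refine h.congr fun n => ?_
    rw [Real.deriv_log_Gamma_nat_add ha, Real.deriv_log_Gamma_nat_add (ha.trans_le hab),
      Finset.sum_sub_distrib]
    ring
  · intro n
    have : 1 / ((n : ℝ) + b) ≤ 1 / ((n : ℝ) + a) := by gcongr
    linarith

theorem Real.hasSum_deriv_log_Gamma_sub {a b : ℝ} (ha : 0 < a) (hb : 0 < b) :
    HasSum (fun n : ℕ => 1 / ((n : ℝ) + a) - 1 / ((n : ℝ) + b))
      (deriv (fun y => Real.log (Real.Gamma y)) b -
        deriv (fun y => Real.log (Real.Gamma y)) a) := by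
  rcases le_total a b with h | h
  · exact Real.hasSum_deriv_log_Gamma_sub_of_le ha h
  · simpa using (Real.hasSum_deriv_log_Gamma_sub_of_le hb h).neg

theorem Real.deriv_log_Gamma_two_mul {x : ℝ} (hx : 0 < x) :
    2 * deriv (fun y => Real.log (Real.Gamma y)) (2 * x) =
      deriv (fun y => Real.log (Real.Gamma y)) x +
        deriv (fun y => Real.log (Real.Gamma y)) (x + 1 / 2) + 2 * Real.log 2 := by
  have h1 := (Real.hasDerivAt_log_Gamma hx).add
    ((Real.hasDerivAt_log_Gamma (by linarith : 0 < x + 1 / 2)).comp_add_const x (1 / 2))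
  have hl : HasDerivAt (fun y : ℝ => 2 * y) 2 x := by
    simpa using (hasDerivAt_id x).const_mul (2 : ℝ)
  have h2 := ((Real.hasDerivAt_log_Gamma (by linarith : 0 < 2 * x)).comp x hl).add
    (((hl.const_sub 1).mul_const (Real.log 2)).add_const (Real.log (√Real.pi)))
  have := h1.unique (h2.congr_of_eventuallyEq ?_)
  · linarith
  · filter_upwards [eventually_gt_nhds hx] with y hy
    have hy2 := Real.Gamma_pos_of_pos (by linarith : 0 < 2 * y)
    have hyh := Real.Gamma_pos_of_pos (by linarith : 0 < y + 1 / 2)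
    have h := congrArg Real.log (Real.Gamma_mul_Gamma_add_half y)
    rw [Real.log_mul (Real.Gamma_pos_of_pos hy).ne' hyh.ne',
      Real.log_mul (by positivity) (by positivity), Real.log_mul hy2.ne' (by positivity),
      Real.log_rpow two_pos] at h
    simp only [Pi.add_apply, Function.comp_apply]
    linarith

theorem Phi_eq_exp {x : ℝ} (hx : 1 < x) :
    Phi x = Real.exp (Real.log 2 + (x - 1) * Real.log (1 - 1 / x) +
      (Real.log (Real.Gamma (1 / 2 + x / 2)) + Real.log (Real.Gamma x)) -
      (Real.log (Real.Gamma (1 + x / 2)) + Real.log (Real.Gamma (-1 / 2 + x)))) := by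
  have h0 : 0 < 1 - 1 / x := by
    rw [sub_pos, div_lt_one (by linarith)]
    exact hx
  rw [Phi, Real.exp_sub, Real.exp_add, Real.exp_add, Real.exp_add, Real.exp_add,
    Real.exp_log two_pos, Real.exp_log (Real.Gamma_pos_of_pos (by linarith)),
    Real.exp_log (Real.Gamma_pos_of_pos (by linarith)),
    Real.exp_log (Real.Gamma_pos_of_pos (by linarith)),
    Real.exp_log (Real.Gamma_pos_of_pos (by linarith)), Real.rpow_def_of_pos h0,
    mul_comm (x - 1)]

theorem deriv_Phi_div_Phi {x : ℝ} (hx : 1 < x) :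
    deriv Phi x / Phi x = Real.log (1 - 1 / x) + 1 / x +
      (deriv (fun y => Real.log (Real.Gamma y)) (1 / 2 + x / 2) / 2 +
        deriv (fun y => Real.log (Real.Gamma y)) x) -
      (deriv (fun y => Real.log (Real.Gamma y)) (1 + x / 2) / 2 +
        deriv (fun y => Real.log (Real.Gamma y)) (-1 / 2 + x)) := by
  have hx0 : x ≠ 0 := by linarith
  have hx1 : x - 1 ≠ 0 := by linarith
  have h0 : 0 < 1 - 1 / x := by
    rw [sub_pos, div_lt_one (by linarith)]
    exact hx
  have hhalf (c : ℝ) : HasDerivAt (fun y : ℝ => c + y / 2) (1 / 2) x :=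
    ((hasDerivAt_id x).div_const 2).const_add c
  have hinv : HasDerivAt (fun y : ℝ => 1 - 1 / y) (1 / x ^ 2) x := by
    simpa [one_div] using (hasDerivAt_inv hx0).const_sub 1
  have hpow := (((hasDerivAt_id x).sub_const 1).mul (hinv.log h0.ne')).const_add (Real.log 2)
  have hA := (Real.hasDerivAt_log_Gamma (by linarith : 0 < 1 / 2 + x / 2)).comp x (hhalf (1 / 2))
  have hB := (Real.hasDerivAt_log_Gamma (by linarith : 0 < 1 + x / 2)).comp x (hhalf 1)
  have hC := (Real.hasDerivAt_log_Gamma (by linarith : 0 < -1 / 2 + x)).comp_const_add (-1 / 2) x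
  have hD := Real.hasDerivAt_log_Gamma (by linarith : 0 < x)
  have h := ((hpow.add (hA.add hD)).sub (hB.add hC)).exp
  have hPhi : HasDerivAt Phi _ x :=
    h.congr_of_eventuallyEq ((eventually_gt_nhds hx).mono fun y hy => Phi_eq_exp hy)
  rw [hPhi.deriv, Phi_eq_exp hx]
  refine (mul_div_cancel_left₀ _ (Real.exp_pos _).ne').trans ?_
  have hlog : (x - 1) * (1 / x ^ 2 / (1 - 1 / x)) = 1 / x := by
    field_simp
  simp only [id_eq, hlog]
  ring

theorem stmt_3 (s : ℝ) (hs : s > -1) :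
    deriv Phi (s + 2) / Phi (s + 2) =
      Real.log ((1 + s) / (1 + s / 2)) -
        ∑' n : ℕ, (1 / ((n : ℝ) + 3/2 + s/2) - 1 / ((n : ℝ) + 3/2 + s)) := by
  have hsum := (Real.hasSum_deriv_log_Gamma_sub (by linarith : 0 < 3 / 2 + s / 2)
    (by linarith : 0 < 3 / 2 + s)).tsum_eq
  simp only [← add_assoc] at hsum
  have hdup := Real.deriv_log_Gamma_two_mul (by linarith : 0 < 1 + s / 2)
  have hstep := Real.deriv_log_Gamma_add_one (by linarith : 0 < 1 + s / 2)
  have hlog : Real.log ((1 + s) / (1 + s / 2)) = Real.log (1 - 1 / (s + 2)) + Real.log 2 := by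
    have h1 : s + 2 ≠ 0 := by linarith
    have h2 : 1 - 1 / (s + 2) = (1 + s) / (s + 2) := by
      field_simp
      ring
    have h3 : 1 + s / 2 = (s + 2) / 2 := by ring
    have h4 : 0 < (1 + s) / (s + 2) := div_pos (by linarith) (by linarith)
    rw [h2, ← Real.log_mul h4.ne' two_ne_zero, h3, div_div_eq_mul_div, div_mul_eq_mul_div]
  have hinv : 1 / (1 + s / 2) = 2 * (1 / (s + 2)) := by
    have h1 : s + 2 ≠ 0 := by linarith
    have h2 : 1 + s / 2 = (s + 2) / 2 := by ring
    rw [h2]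
    field_simp
  rw [hsum, deriv_Phi_div_Phi (by linarith : 1 < s + 2), hlog,
    show 1 / 2 + (s + 2) / 2 = 3 / 2 + s / 2 by ring,
    show 1 + (s + 2) / 2 = 1 + s / 2 + 1 by ring,
    show -1 / 2 + (s + 2) = 3 / 2 + s by ring, hstep, hinv]
  rw [show 2 * (1 + s / 2) = s + 2 by ring,
    show 1 + s / 2 + 1 / 2 = 3 / 2 + s / 2 by ring] at hdup
  linarith
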